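/- arXiv:2405.20823 — 5 statements merged into one kernel-verified Lean document; each statement's English description precedes it below -/
import Mathlib

section
/- The 22×17 integer matrix T, whose columns are indexed by the zigzag multiplicities A,B,C,D,E,F,G,H,I,L,M,N,O,P,Q,R,S and whose rows are the coefficient vectors of the 22 linear forms h01σ, h01p, h01BC, h01A, b1, h1_11, h1_12, h02σ, h02p, b2, h11σ, h11BC, h11A, h2_12, h03σ, h12σ, h12BC, b3, h3_13, h3_22, h3_23, h4_23 (in this order), has rank 17 over ℚ. -/
/-- The 22×17 matrix T of Table 1 (rows: the 22 cohomological linear forms; columns: zigzag multiplicities A,…,S). -/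
def T : Matrix (Fin 22) (Fin 17) ℚ :=
  !![1, 0, 0, 1, 0, 1, 1, 0, 0, 0, 0, 0, 0, 0, 0, 0, 0;
     1, 1, 0, 0, 0, 0, 0, 0, 0, 0, 0, 0, 0, 0, 0, 0, 0;
     1, 0, 0, 0, 0, 0, 0, 0, 0, 0, 0, 0, 0, 0, 0, 0, 0;
     1, 1, 1, 2, 1, 1, 1, 0, 0, 0, 0, 0, 0, 0, 0, 0, 0;
     2, 0, 0, 0, 0, 0, 1, 0, 0, 0, 0, 0, 0, 0, 0, 0, 0;
     2, 2, 0, 2, 1, 0, 1, 0, 0, 0, 0, 0, 0, 0, 0, 0, 0;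
     2, 1, 0, 1, 0, 0, 1, 0, 0, 0, 0, 0, 0, 0, 0, 0, 0;
     0, 0, 0, 0, 0, 0, 0, 1, 1, 1, 1, 1, 0, 0, 0, 0, 0;
     0, 1, 1, 1, 1, 0, 0, 1, 0, 0, 0, 0, 0, 0, 0, 0, 0;
     0, 0, 2, 0, 1, 0, 0, 2, 0, 2, 0, 1, 1, 0, 0, 0, 0;
     0, 0, 1, 0, 0, 1, 0, 0, 0, 1, 0, 0, 1, 1, 0, 0, 0;
     0, 0, 2, 2, 1, 2, 1, 0, 0, 0, 0, 0, 1, 0, 0, 0, 0;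
     0, 0, 0, 0, 0, 0, 0, 0, 0, 2, 2, 1, 1, 2, 1, 0, 0;
     0, 0, 1, 0, 0, 0, 0, 1, 0, 2, 1, 1, 1, 1, 0, 0, 0;
     0, 0, 0, 0, 0, 0, 0, 0, 0, 0, 0, 0, 0, 0, 0, 1, 0;
     0, 0, 0, 0, 0, 0, 0, 0, 1, 0, 1, 0, 0, 1, 1, 0, 1;
     0, 0, 0, 0, 0, 0, 0, 0, 1, 1, 2, 1, 0, 1, 1, 0, 1;
     0, 0, 0, 0, 0, 0, 0, 0, 0, 0, 0, 0, 0, 0, 2, 2, 2;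
     0, 0, 0, 0, 0, 0, 0, 0, 0, 0, 1, 0, 0, 1, 1, 1, 1;
     0, 0, 0, 0, 0, 0, 0, 0, 2, 0, 2, 1, 0, 0, 2, 0, 2;
     0, 0, 0, 0, 0, 0, 0, 0, 1, 0, 1, 0, 0, 0, 2, 1, 2;
     0, 0, 2, 1, 1, 1, 0, 1, 0, 1, 0, 0, 1, 0, 0, 0, 0]

/-- The linear map defined by `T` is injective. -/
theorem T_mulVecLin_injective : Function.Injective T.mulVecLin := by
  rw [← LinearMap.ker_eq_bot, LinearMap.ker_eq_bot']
  intro v hv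
  have h : ∀ i, (T.mulVec v) i = 0 := fun i => congrFun hv i
  simp [Fin.forall_fin_succ, T, Matrix.mulVec, dotProduct, Fin.sum_univ_succ] at h
  obtain ⟨h₀, h₁, h₂, h₃, h₄, h₅, h₆, h₇, h₈, h₉, h₁₀, h₁₁, h₁₂, h₁₃, h₁₄, h₁₅, h₁₆, h₁₇, h₁₈,
    h₁₉, h₂₀, h₂₁⟩ := h
  ext i
  fin_cases i <;> simp <;> linarith

/-- The matrix T has rank 17 over ℚ. -/
theorem T_rank : T.rank = 17 := by
  rw [Matrix.rank, LinearMap.finrank_range_of_inj T_mulVecLin_injective, Module.finrank_fin_fun]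
end

section
/- (Necessity of Bigolin numbers in the main theorem.) The 15×17 integer matrix V obtained from T by deleting the seven rows corresponding to the Bigolin numbers h1_11, h1_12, h2_12, h3_13, h3_22, h3_23, h4_23 (so V has rows h01σ, h01p, h01BC, h01A, b1, h02σ, h02p, b2, h11σ, h11BC, h11A, h03σ, h12σ, h12BC, b3) has rank 14 over ℚ. -/
/-- The 15×17 submatrix V of T obtained by deleting the seven rows corresponding to the
Bigolin numbers h1_11, h1_12, h2_12, h3_13, h3_22, h3_23, h4_23. -/
def V : Matrix (Fin 15) (Fin 17) ℚ :=
  !![1, 0, 0, 1, 0, 1, 1, 0, 0, 0, 0, 0, 0, 0, 0, 0, 0;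
     1, 1, 0, 0, 0, 0, 0, 0, 0, 0, 0, 0, 0, 0, 0, 0, 0;
     1, 0, 0, 0, 0, 0, 0, 0, 0, 0, 0, 0, 0, 0, 0, 0, 0;
     1, 1, 1, 2, 1, 1, 1, 0, 0, 0, 0, 0, 0, 0, 0, 0, 0;
     2, 0, 0, 0, 0, 0, 1, 0, 0, 0, 0, 0, 0, 0, 0, 0, 0;
     0, 0, 0, 0, 0, 0, 0, 1, 1, 1, 1, 1, 0, 0, 0, 0, 0;
     0, 1, 1, 1, 1, 0, 0, 1, 0, 0, 0, 0, 0, 0, 0, 0, 0;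
     0, 0, 2, 0, 1, 0, 0, 2, 0, 2, 0, 1, 1, 0, 0, 0, 0;
     0, 0, 1, 0, 0, 1, 0, 0, 0, 1, 0, 0, 1, 1, 0, 0, 0;
     0, 0, 2, 2, 1, 2, 1, 0, 0, 0, 0, 0, 1, 0, 0, 0, 0;
     0, 0, 0, 0, 0, 0, 0, 0, 0, 2, 2, 1, 1, 2, 1, 0, 0;
     0, 0, 0, 0, 0, 0, 0, 0, 0, 0, 0, 0, 0, 0, 0, 1, 0;
     0, 0, 0, 0, 0, 0, 0, 0, 1, 0, 1, 0, 0, 1, 1, 0, 1;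
     0, 0, 0, 0, 0, 0, 0, 0, 1, 1, 2, 1, 0, 1, 1, 0, 1;
     0, 0, 0, 0, 0, 0, 0, 0, 0, 0, 0, 0, 0, 0, 2, 2, 2]

/-- The coefficients expressing the last row of `V` through the other rows. -/
def lastRowCoeff : Fin 14 → ℚ :=
  ![2, 2, 0, 0, -2, -2, -2, 2, -2, 0, 0, 2, 2, 0]

/-- A right inverse of the first fourteen rows of `V`. -/
def topRowsRightInverse : Matrix (Fin 17) (Fin 14) ℚ :=
  !![0, 0, 1, 0, 0, 0, 0, 0, 0, 0, 0, 0, 0, 0;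
     0, 1, -1, 0, 0, 0, 0, 0, 0, 0, 0, 0, 0, 0;
     1, 0, 0, -1, 0, -1, 1, 0, 1, 0, -1, 0, -1, 2;
     1, 0, 1, 0, -1, 0, 0, 0, 0, 0, 0, 0, 0, 0;
     -3, -1, 0, 2, 1, 1, -1, 0, -1, 0, 1, 0, 1, -2;
     0, 0, 0, 0, 0, 0, 0, 0, 0, 0, 0, 0, 0, 0;
     0, 0, -2, 0, 1, 0, 0, 0, 0, 0, 0, 0, 0, 0;
     1, 0, 0, -1, 0, 0, 1, 0, 0, 0, 0, 0, 0, 0;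
     -1, 0, 0, 1, 0, 1, -1, 0, 0, 0, 0, 0, 1, -1;
     0, -1, 0, 1, 0, 0, 0, 0, 1, -1, 0, 0, 0, 0;
     0, -1, 0, -1, 1, 0, 2, -1, 1, 0, 0, 0, -1, 1;
     0, 2, 0, 0, -1, 0, -2, 1, -2, 1, 0, 0, 0, 0;
     -1, 1, 0, 0, 0, 1, -1, 0, -1, 1, 1, 0, 1, -2;
     0, 0, 0, 0, 0, 0, 0, 0, 0, 0, 0, 0, 0, 0;
     1, 1, 0, 0, -1, -1, -1, 1, -1, 0, 0, 0, 1, 0;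
     0, 0, 0, 0, 0, 0, 0, 0, 0, 0, 0, 1, 0, 0;
     0, 0, 0, 0, 0, 0, 0, 0, 0, 0, 0, 0, 0, 0]

theorem V_eq_mul_topRows :
    V = Matrix.of (Fin.snoc (α := fun _ => Fin 14 → ℚ) (1 : Matrix (Fin 14) (Fin 14) ℚ)
      lastRowCoeff) * V.submatrix Fin.castSucc id := by
  decide +kernel

theorem topRows_mul_rightInverse :
    V.submatrix Fin.castSucc id * topRowsRightInverse = 1 := by
  decide +kernel

/-- The matrix V has rank 14 over ℚ. -/
theorem V_rank : V.rank = 14 := by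
  apply le_antisymm
  · rw [V_eq_mul_topRows]
    exact (Matrix.rank_mul_le_left _ _).trans (Matrix.rank_le_width _)
  · calc
      14 = (V.submatrix Fin.castSucc id * topRowsRightInverse).rank := by
        rw [topRows_mul_rightInverse, Matrix.rank_one, Fintype.card_fin]
      _ ≤ (V.submatrix Fin.castSucc id).rank := Matrix.rank_mul_le_left _ _
      _ ≤ V.rank := Matrix.rank_submatrix_le V Fin.castSucc id
end

section
/- The 16×16 integer matrix U₁ obtained from the 17×17 matrix U (the submatrix of T with rows h01σ, h01p, h01BC, h01A, b1, h1_11, h1_12, h02σ, h02p, b2, h11σ, h11BC, h11A, h03σ, h12σ, h12BC, h4_23) by deleting the row corresponding to h1_12 and the column corresponding to the variable D has rank 16 over ℚ; equivalently, its determinant is nonzero. -/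
/-- The 16×16 matrix U₁: the 17×17 matrix U (rows h01σ, h01p, h01BC, h01A, b1, h1_11,
h1_12, h02σ, h02p, b2, h11σ, h11BC, h11A, h03σ, h12σ, h12BC, h4_23 of T) with the row
h1_12 and the column D deleted. -/
def U1 : Matrix (Fin 16) (Fin 16) ℚ :=
  !![1, 0, 0, 0, 1, 1, 0, 0, 0, 0, 0, 0, 0, 0, 0, 0;
     1, 1, 0, 0, 0, 0, 0, 0, 0, 0, 0, 0, 0, 0, 0, 0;
     1, 0, 0, 0, 0, 0, 0, 0, 0, 0, 0, 0, 0, 0, 0, 0;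
     1, 1, 1, 1, 1, 1, 0, 0, 0, 0, 0, 0, 0, 0, 0, 0;
     2, 0, 0, 0, 0, 1, 0, 0, 0, 0, 0, 0, 0, 0, 0, 0;
     2, 2, 0, 1, 0, 1, 0, 0, 0, 0, 0, 0, 0, 0, 0, 0;
     0, 0, 0, 0, 0, 0, 1, 1, 1, 1, 1, 0, 0, 0, 0, 0;
     0, 1, 1, 1, 0, 0, 1, 0, 0, 0, 0, 0, 0, 0, 0, 0;
     0, 0, 2, 1, 0, 0, 2, 0, 2, 0, 1, 1, 0, 0, 0, 0;
     0, 0, 1, 0, 1, 0, 0, 0, 1, 0, 0, 1, 1, 0, 0, 0;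
     0, 0, 2, 1, 2, 1, 0, 0, 0, 0, 0, 1, 0, 0, 0, 0;
     0, 0, 0, 0, 0, 0, 0, 0, 2, 2, 1, 1, 2, 1, 0, 0;
     0, 0, 0, 0, 0, 0, 0, 0, 0, 0, 0, 0, 0, 0, 1, 0;
     0, 0, 0, 0, 0, 0, 0, 1, 0, 1, 0, 0, 1, 1, 0, 1;
     0, 0, 0, 0, 0, 0, 0, 1, 1, 2, 1, 0, 1, 1, 0, 1;
     0, 0, 2, 1, 1, 0, 1, 0, 1, 0, 0, 1, 0, 0, 0, 0]

theorem U1_mulVec_eq_zero {v : Fin 16 → ℚ} (h : U1.mulVec v = 0) : v = 0 := by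
  have hrow (i : Fin 16) : ∑ j, U1 i j * v j = 0 := congrFun h i
  have h0 := hrow 0
  have h1 := hrow 1
  have h2 := hrow 2
  have h3 := hrow 3
  have h4 := hrow 4
  have h5 := hrow 5
  have h6 := hrow 6
  have h7 := hrow 7
  have h8 := hrow 8
  have h9 := hrow 9
  have h10 := hrow 10
  have h11 := hrow 11
  have h12 := hrow 12
  have h13 := hrow 13
  have h14 := hrow 14
  have h15 := hrow 15
  simp [U1, Fin.sum_univ_succ] at h0 h1 h2 h3 h4 h5 h6 h7 h8 h9 h10 h11 h12 h13 h14 h15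
  ext i
  fin_cases i <;> simp <;> linarith

/-- U₁ has rank 16 over ℚ; equivalently, its determinant is nonzero. -/
theorem U1_rank : U1.rank = 16 ∧ U1.det ≠ 0 := by
  have hdet : U1.det ≠ 0 := fun h => by
    obtain ⟨v, hv, h⟩ := Matrix.exists_mulVec_eq_zero_iff.mpr h
    exact hv (U1_mulVec_eq_zero h)
  refine ⟨?_, hdet⟩
  simpa using Matrix.rank_of_isUnit U1 ((Matrix.isUnit_iff_isUnit_det U1).mpr hdet.isUnit)
end

section
/- The 14×16 integer matrix U₂ obtained from V (the submatrix of T with rows h01σ, h01p, h01BC, h01A, b1, h02σ, h02p, b2, h11σ, h11BC, h11A, h03σ, h12σ, h12BC, b3) by deleting the row corresponding to b3 and the column corresponding to the variable D has rank 14 over ℚ; equivalently, the kernel of the associated ℚ-linear map ℚ¹⁶ → ℚ¹⁴ has dimension 2. -/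
/-- The 14×16 matrix U₂: the matrix V (rows h01σ, h01p, h01BC, h01A, b1, h02σ, h02p, b2,
h11σ, h11BC, h11A, h03σ, h12σ, h12BC, b3 of T) with the row b3 and the column D deleted. -/
def U2 : Matrix (Fin 14) (Fin 16) ℚ :=
  !![1, 0, 0, 0, 1, 1, 0, 0, 0, 0, 0, 0, 0, 0, 0, 0;
     1, 1, 0, 0, 0, 0, 0, 0, 0, 0, 0, 0, 0, 0, 0, 0;
     1, 0, 0, 0, 0, 0, 0, 0, 0, 0, 0, 0, 0, 0, 0, 0;
     1, 1, 1, 1, 1, 1, 0, 0, 0, 0, 0, 0, 0, 0, 0, 0;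
     2, 0, 0, 0, 0, 1, 0, 0, 0, 0, 0, 0, 0, 0, 0, 0;
     0, 0, 0, 0, 0, 0, 1, 1, 1, 1, 1, 0, 0, 0, 0, 0;
     0, 1, 1, 1, 0, 0, 1, 0, 0, 0, 0, 0, 0, 0, 0, 0;
     0, 0, 2, 1, 0, 0, 2, 0, 2, 0, 1, 1, 0, 0, 0, 0;
     0, 0, 1, 0, 1, 0, 0, 0, 1, 0, 0, 1, 1, 0, 0, 0;
     0, 0, 2, 1, 2, 1, 0, 0, 0, 0, 0, 1, 0, 0, 0, 0;
     0, 0, 0, 0, 0, 0, 0, 0, 2, 2, 1, 1, 2, 1, 0, 0;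
     0, 0, 0, 0, 0, 0, 0, 0, 0, 0, 0, 0, 0, 0, 1, 0;
     0, 0, 0, 0, 0, 0, 0, 1, 0, 1, 0, 0, 1, 1, 0, 1;
     0, 0, 0, 0, 0, 0, 0, 1, 1, 2, 1, 0, 1, 1, 0, 1]

/-- The rows of `U2` are linearly independent. -/
theorem linearIndependent_row_U2 : LinearIndependent ℚ U2.row := by
  rw [Fintype.linearIndependent_iff]
  intro g hg
  have h : ∀ j : Fin 16, ∑ i, g i * U2 i j = 0 := fun j => by
    simpa [Finset.sum_apply, Matrix.row] using congrFun hg j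
  simp only [U2, Fin.sum_univ_succ, Fin.forall_fin_succ] at h
  simp [Fin.forall_fin_succ] at h ⊢
  grind

/-- U₂ has rank 14 over ℚ; equivalently, the kernel of the associated linear map
ℚ¹⁶ → ℚ¹⁴ has dimension 2. -/
theorem U2_rank : U2.rank = 14 ∧ Module.finrank ℚ (LinearMap.ker U2.mulVecLin) = 2 := by
  have hrank : U2.rank = 14 := by
    simpa using linearIndependent_row_U2.rank_matrix
  refine ⟨hrank, ?_⟩
  have h := U2.mulVecLin.finrank_range_add_finrank_ker
  rw [Matrix.rank] at hrank
  rw [hrank, Module.finrank_fin_fun] at h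
  omega
end

section
/- (Necessity of Hodge numbers in the main theorem.) The 19×17 integer matrix obtained from T by deleting the three rows corresponding to h01p, h11σ, and h12σ has rank 15 over ℚ. -/
/-- The 19×17 matrix obtained from T by deleting the three rows corresponding to
h01p, h11σ and h12σ. -/
def W : Matrix (Fin 19) (Fin 17) ℚ :=
  !![1, 0, 0, 1, 0, 1, 1, 0, 0, 0, 0, 0, 0, 0, 0, 0, 0;
     1, 0, 0, 0, 0, 0, 0, 0, 0, 0, 0, 0, 0, 0, 0, 0, 0;
     1, 1, 1, 2, 1, 1, 1, 0, 0, 0, 0, 0, 0, 0, 0, 0, 0;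
     2, 0, 0, 0, 0, 0, 1, 0, 0, 0, 0, 0, 0, 0, 0, 0, 0;
     2, 2, 0, 2, 1, 0, 1, 0, 0, 0, 0, 0, 0, 0, 0, 0, 0;
     2, 1, 0, 1, 0, 0, 1, 0, 0, 0, 0, 0, 0, 0, 0, 0, 0;
     0, 0, 0, 0, 0, 0, 0, 1, 1, 1, 1, 1, 0, 0, 0, 0, 0;
     0, 1, 1, 1, 1, 0, 0, 1, 0, 0, 0, 0, 0, 0, 0, 0, 0;
     0, 0, 2, 0, 1, 0, 0, 2, 0, 2, 0, 1, 1, 0, 0, 0, 0;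
     0, 0, 2, 2, 1, 2, 1, 0, 0, 0, 0, 0, 1, 0, 0, 0, 0;
     0, 0, 0, 0, 0, 0, 0, 0, 0, 2, 2, 1, 1, 2, 1, 0, 0;
     0, 0, 1, 0, 0, 0, 0, 1, 0, 2, 1, 1, 1, 1, 0, 0, 0;
     0, 0, 0, 0, 0, 0, 0, 0, 0, 0, 0, 0, 0, 0, 0, 1, 0;
     0, 0, 0, 0, 0, 0, 0, 0, 1, 1, 2, 1, 0, 1, 1, 0, 1;
     0, 0, 0, 0, 0, 0, 0, 0, 0, 0, 0, 0, 0, 0, 2, 2, 2;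
     0, 0, 0, 0, 0, 0, 0, 0, 0, 0, 1, 0, 0, 1, 1, 1, 1;
     0, 0, 0, 0, 0, 0, 0, 0, 2, 0, 2, 1, 0, 0, 2, 0, 2;
     0, 0, 0, 0, 0, 0, 0, 0, 1, 0, 1, 0, 0, 0, 2, 1, 2;
     0, 0, 2, 1, 1, 1, 0, 1, 0, 1, 0, 0, 1, 0, 0, 0, 0]

/-- Indices of a maximal linearly independent set of columns of `W`. -/
def pivotColumn : Fin 15 → Fin 17 :=
  ![0, 1, 2, 3, 4, 6, 7, 8, 9, 10, 11, 12, 14, 15, 16]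

/-- The coordinates of the columns of `W` with respect to its pivot columns, that is, the nonzero
rows of its reduced row echelon form. -/
def columnCoordinates : Matrix (Fin 15) (Fin 17) ℚ :=
  !![1, 0, 0, 0, 0, 0, 0, 0, 0, 0, 0, 0, 0, 0, 0, 0, 0;
     0, 1, 0, 0, 0, -1, 0, 0, 0, 0, 0, 0, 0, 0, 0, 0, 0;
     0, 0, 1, 0, 0, 0, 0, 0, 0, 0, 0, 0, 0, 0, 0, 0, 0;
     0, 0, 0, 1, 0, 1, 0, 0, 0, 0, 0, 0, 0, 0, 0, 0, 0;
     0, 0, 0, 0, 1, 0, 0, 0, 0, 0, 0, 0, 0, 0, 0, 0, 0;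
     0, 0, 0, 0, 0, 0, 1, 0, 0, 0, 0, 0, 0, 0, 0, 0, 0;
     0, 0, 0, 0, 0, 0, 0, 1, 0, 0, 0, 0, 0, 0, 0, 0, 0;
     0, 0, 0, 0, 0, 0, 0, 0, 1, 0, 0, 0, 0, -1, 0, 0, 0;
     0, 0, 0, 0, 0, 0, 0, 0, 0, 1, 0, 0, 0, 0, 0, 0, 0;
     0, 0, 0, 0, 0, 0, 0, 0, 0, 0, 1, 0, 0, 1, 0, 0, 0;
     0, 0, 0, 0, 0, 0, 0, 0, 0, 0, 0, 1, 0, 0, 0, 0, 0;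
     0, 0, 0, 0, 0, 0, 0, 0, 0, 0, 0, 0, 1, 0, 0, 0, 0;
     0, 0, 0, 0, 0, 0, 0, 0, 0, 0, 0, 0, 0, 0, 1, 0, 0;
     0, 0, 0, 0, 0, 0, 0, 0, 0, 0, 0, 0, 0, 0, 0, 1, 0;
     0, 0, 0, 0, 0, 0, 0, 0, 0, 0, 0, 0, 0, 0, 0, 0, 1]

/-- A left inverse of the matrix of pivot columns of `W`. -/
def pivotLeftInverse : Matrix (Fin 15) (Fin 19) ℚ :=
  !![0, 1, 0, 0, 0, 0, 0, 0, 0, 0, 0, 0, 0, 0, 0, 0, 0, 0, 0;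
     -1, -1, 0, 0, 0, 1, 0, 0, 0, 0, 0, 0, 0, 0, 0, 0, 0, 0, 0;
     -1, 0, 1, 0, -1, 1, 0, 0, 0, 0, 0, 0, 0, 0, 0, 0, 0, 0, 0;
     1, 1, 0, -1, 0, 0, 0, 0, 0, 0, 0, 0, 0, 0, 0, 0, 0, 0, 0;
     0, 0, 0, 1, 1, -2, 0, 0, 0, 0, 0, 0, 0, 0, 0, 0, 0, 0, 0;
     0, -2, 0, 1, 0, 0, 0, 0, 0, 0, 0, 0, 0, 0, 0, 0, 0, 0, 0;
     1, 0, -1, 0, 0, 0, 0, 1, 0, 0, 0, 0, 0, 0, 0, 0, 0, 0, 0;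
     -2, 0, 2, 1, 0, -1, 2, -1, -1, 0, 0, 1, -1, -2, 0, 0, 0, 1, 0;
     -1, 0, 3, 1, 0, -2, 1, -1, -1, -1, 0, 2, -1, -2, 0, 0, 0, 1, 0;
     0, 0, 0, 1, 0, -1, 0, 1, -1, 0, 0, 1, 0, 0, 0, 0, 0, 0, 0;
     2, 0, -4, -3, 0, 4, -2, 0, 3, 1, 0, -4, 2, 4, 0, 0, 0, -2, 0;
     0, 0, -2, 0, 1, 0, 0, 0, 0, 1, 0, 0, 0, 0, 0, 0, 0, 0, 0;
     0, 0, 0, -1, -1, 2, 0, 0, 1, 0, 1, -2, 0, 0, 0, 0, 0, 0, 0;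
     0, 0, 0, 0, 0, 0, 0, 0, 0, 0, 0, 0, 1, 0, 0, 0, 0, 0, 0;
     1, 0, -1, 0, 1, -1, -1, 0, 0, 0, -1, 1, 0, 1, 0, 0, 0, 0, 0]

theorem pivotLeftInverse_mul_submatrix :
    pivotLeftInverse * W.submatrix id pivotColumn = 1 := by
  decide +kernel

theorem submatrix_mul_columnCoordinates :
    W.submatrix id pivotColumn * columnCoordinates = W := by
  decide +kernel

/-- The matrix W has rank 15 over ℚ. -/
theorem W_rank : W.rank = 15 := by
  apply le_antisymm
  · rw [← submatrix_mul_columnCoordinates]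
    exact (Matrix.rank_mul_le_left _ _).trans (Matrix.rank_le_width _)
  · calc
      15 = (1 : Matrix (Fin 15) (Fin 15) ℚ).rank := by simp
      _ = (pivotLeftInverse * W.submatrix id pivotColumn).rank := by
        rw [pivotLeftInverse_mul_submatrix]
      _ ≤ (W.submatrix id pivotColumn).rank := Matrix.rank_mul_le_right _ _
      _ ≤ W.rank := Matrix.rank_submatrix_le _ _ _
end
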